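/- arXiv:1310.7683 — 3 statements merged into one kernel-verified Lean document; each statement's English description precedes it below -/
import Mathlib

section
/- Let $V_1$ and $V_2$ be two finite-dimensional irreducible complex representations of a connected, simply connected complex simple Lie group $\widetilde{G}$ (equivalently, of a complex simple Lie algebra $\mathfrak{g}$), such that both $V_1$ and $V_2$ are nontrivial. Then the representation $V_1 \otimes V_2$ is not irreducible. -/
open scoped TensorProduct

/-- **Schur's lemma** for Lie modules over an algebraically closed field. -/
theorem LieModule.IsIrreducible.exists_eq_smul_of_commute {K L M : Type*} [Field K] [IsAlgClosed K]
    [LieRing L] [LieAlgebra K L] [AddCommGroup M] [Module K M] [LieRingModule L M]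
    [LieModule K L M] [FiniteDimensional K M] (h : LieModule.IsIrreducible K L M)
    (f : Module.End K M) (hf : ∀ (x : L) (m : M), f ⁅x, m⁆ = ⁅x, f m⁆) :
    ∃ c : K, ∀ m, f m = c • m := by
  have : Nontrivial M := (LieSubmodule.nontrivial_iff K L M).mp h.toNontrivial
  obtain ⟨c, hc⟩ := Module.End.exists_eigenvalue f
  let N : LieSubmodule K L M :=
    { f.eigenspace c with
      lie_mem := fun {x m} hm ↦ by
        have hm' : f m = c • m := Module.End.mem_eigenspace_iff.mp hm
        refine Module.End.mem_eigenspace_iff.mpr ?_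
        rw [hf, hm', lie_smul] }
  have hN : N = ⊤ := (h.eq_bot_or_eq_top N).resolve_left fun hbot ↦ by
    obtain ⟨v, hv, hv0⟩ := hc.exists_hasEigenvector
    have hvN : v ∈ N := hv
    rw [hbot] at hvN
    exact hv0 ((LieSubmodule.mem_bot v).mp hvN)
  refine ⟨c, fun m ↦ Module.End.mem_eigenspace_iff.mp ?_⟩
  have hm : m ∈ N := hN ▸ LieSubmodule.mem_top m
  exact hm

/-- The canonical element attached to dual bases for the Killing form is invariant. -/
theorem LieAlgebra.IsKilling.sum_lie_dualBasis_add_eq_zero {K L A ι : Type*} [Field K] [LieRing L]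
    [LieAlgebra K L] [FiniteDimensional K L] [LieAlgebra.IsKilling K L] [AddCommGroup A]
    [Module K A] [Fintype ι] [DecidableEq ι] (b : Module.Basis ι K L) (F : L →ₗ[K] L →ₗ[K] A)
    (x : L) :
    let b' := (killingForm K L).dualBasis (killingForm_nondegenerate K L) b
    ∑ i, (F ⁅x, b i⁆ (b' i) + F (b i) ⁅x, b' i⁆) = 0 := by
  intro b'
  have hb' (y : L) : y = ∑ j, killingForm K L y (b j) • b' j := by
    conv_lhs => rw [← b'.sum_repr y]
    simp only [b', LinearMap.BilinForm.dualBasis_repr_apply]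
  have hb (y : L) : y = ∑ j, killingForm K L y (b' j) • b j := by
    have hdd := LinearMap.BilinForm.dualBasis_dualBasis (killingForm_nondegenerate K L)
      ⟨LieModule.traceForm_comm K L L⟩ b
    conv_lhs => rw [← b.sum_repr y]
    refine Finset.sum_congr rfl fun j _ ↦ ?_
    rw [← LinearMap.BilinForm.dualBasis_repr_apply (killingForm_nondegenerate K L), hdd]
  have h₁ (i : ι) : F ⁅x, b i⁆ (b' i) = ∑ j, killingForm K L ⁅x, b i⁆ (b' j) • F (b j) (b' i) := by
    conv_lhs => rw [hb ⁅x, b i⁆]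
    simp
  have h₂ (i : ι) : F (b i) ⁅x, b' i⁆ = ∑ j, killingForm K L ⁅x, b' i⁆ (b j) • F (b i) (b' j) := by
    conv_lhs => rw [hb' ⁅x, b' i⁆]
    simp
  simp_rw [Finset.sum_add_distrib, h₁, h₂]
  rw [Finset.sum_comm, ← Finset.sum_add_distrib]
  refine Finset.sum_eq_zero fun i _ ↦ ?_
  rw [← Finset.sum_add_distrib]
  refine Finset.sum_eq_zero fun j _ ↦ ?_
  rw [← add_smul, LieModule.traceForm_apply_lie_apply' K L L x (b j) (b' i),
    LieModule.traceForm_comm K L L (b j), neg_add_cancel, zero_smul]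

/-- A nontrivial module over a simple Lie algebra is faithful. -/
theorem LieAlgebra.IsSimple.eq_zero_of_forall_lie_eq_zero {K L M : Type*} [Field K]
    [LieRing L] [LieAlgebra K L] [LieAlgebra.IsSimple K L] [AddCommGroup M] [Module K M]
    [LieRingModule L M] [LieModule K L M] (hM : ¬ LieModule.IsTrivial L M)
    {x : L} (hx : ∀ m : M, ⁅x, m⁆ = 0) : x = 0 := by
  have hxk : x ∈ LieModule.ker K L M := (LieModule.mem_ker K L M _).mpr hx
  rcases LieAlgebra.IsSimple.eq_bot_or_eq_top (LieModule.ker K L M) with h | h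
  · rw [h] at hxk
    exact (LieSubmodule.mem_bot x).mp hxk
  · exact absurd ⟨fun y m ↦ (LieModule.mem_ker K L M _).mp (h ▸ LieSubmodule.mem_top y) m⟩ hM

/-- A nonzero element of a simple Lie algebra does not act on a nontrivial module by a scalar. -/
theorem LieAlgebra.IsSimple.eq_zero_of_forall_lie_eq_smul {K L M : Type*} [Field K]
    [LieRing L] [LieAlgebra K L] [LieAlgebra.IsSimple K L] [AddCommGroup M] [Module K M]
    [LieRingModule L M] [LieModule K L M] (hM : ¬ LieModule.IsTrivial L M)
    {y : L} {c : K} (hy : ∀ m : M, ⁅y, m⁆ = c • m) : y = 0 := by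
  have hL : ¬ LieModule.IsTrivial L L := LieAlgebra.IsSimple.non_abelian K
  refine eq_zero_of_forall_lie_eq_zero (K := K) hL fun x ↦
    eq_zero_of_forall_lie_eq_zero (K := K) hM fun m ↦ ?_
  rw [lie_lie, hy, hy, lie_smul, sub_self]

/-- If `V₁` and `V₂` are finite-dimensional irreducible nontrivial complex
representations of a connected simply connected complex simple Lie group (equivalently,
of its complex simple Lie algebra `g`), then `V₁ ⊗ V₂` is not irreducible.
(Formalized at the level of the simple Lie algebra, per the stated equivalence; a
representation of the group is trivial iff the Lie algebra acts by zero.) -/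
theorem tensor_product_of_nontrivial_irreducibles_not_irreducible
    (g : Type*) [LieRing g] [LieAlgebra ℂ g] [LieAlgebra.IsSimple ℂ g]
    [FiniteDimensional ℂ g]
    (V₁ V₂ : Type*)
    [AddCommGroup V₁] [Module ℂ V₁] [LieRingModule g V₁] [LieModule ℂ g V₁]
    [FiniteDimensional ℂ V₁]
    [AddCommGroup V₂] [Module ℂ V₂] [LieRingModule g V₂] [LieModule ℂ g V₂]
    [FiniteDimensional ℂ V₂]
    (h₁ : LieModule.IsIrreducible ℂ g V₁) (h₂ : LieModule.IsIrreducible ℂ g V₂)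
    (ht₁ : ¬ LieModule.IsTrivial g V₁) (ht₂ : ¬ LieModule.IsTrivial g V₂) :
    ¬ LieModule.IsIrreducible ℂ g (V₁ ⊗[ℂ] V₂) := by
  intro h
  classical
  let b := Module.finBasis ℂ g
  let b' := (killingForm ℂ g).dualBasis (LieAlgebra.IsKilling.killingForm_nondegenerate ℂ g) b
  let ρ₁ := LieModule.toEnd ℂ g V₁
  let ρ₂ := LieModule.toEnd ℂ g V₂
  let Ω : Module.End ℂ (V₁ ⊗[ℂ] V₂) := ∑ i, TensorProduct.map (ρ₁ (b i)) (ρ₂ (b' i))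
  have hΩ (v : V₁) (w : V₂) : Ω (v ⊗ₜ w) = ∑ i, ⁅b i, v⁆ ⊗ₜ[ℂ] ⁅b' i, w⁆ := by
    simp [Ω, ρ₁, ρ₂]
  have hcomm (x : g) (m : V₁ ⊗[ℂ] V₂) : Ω ⁅x, m⁆ = ⁅x, Ω m⁆ := by
    induction m with
    | zero => simp
    | add m n hm hn => rw [lie_add, map_add, map_add, lie_add, hm, hn]
    | tmul v w =>
      let F : g →ₗ[ℂ] g →ₗ[ℂ] V₁ ⊗[ℂ] V₂ :=
        (TensorProduct.mk ℂ V₁ V₂).compl₁₂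
          ((LieModule.toEnd ℂ g V₁ : g →ₗ[ℂ] Module.End ℂ V₁).flip v)
          ((LieModule.toEnd ℂ g V₂ : g →ₗ[ℂ] Module.End ℂ V₂).flip w)
      have hF (y z : g) : F y z = ⁅y, v⁆ ⊗ₜ[ℂ] ⁅z, w⁆ := rfl
      have hinv := LieAlgebra.IsKilling.sum_lie_dualBasis_add_eq_zero b F x
      rw [TensorProduct.LieModule.lie_tmul_right, map_add, hΩ, hΩ, hΩ, eq_comm, ← sub_eq_zero,
        ← hinv, lie_sum, ← Finset.sum_add_distrib, ← Finset.sum_sub_distrib]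
      refine Finset.sum_congr rfl fun i _ ↦ ?_
      simp only [hF, TensorProduct.LieModule.lie_tmul_right, lie_lie, TensorProduct.sub_tmul,
        TensorProduct.tmul_sub]
      abel
  obtain ⟨c, hc⟩ := h.exists_eq_smul_of_commute Ω hcomm
  have hzero (w : V₂) (f : Module.Dual ℂ V₂) (i) : f ⁅b' i, w⁆ = 0 := by
    have hy : ∑ j, f ⁅b' j, w⁆ • b j = 0 := by
      refine LieAlgebra.IsSimple.eq_zero_of_forall_lie_eq_smul (c := c * f w) ht₁ fun v ↦ ?_
      have := congrArg ((TensorProduct.rid ℂ V₁).toLinearMap ∘ₗ f.lTensor V₁) ((hΩ v w).symm.trans (hc _))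
      simpa [sum_lie, mul_smul] using this
    exact Fintype.linearIndependent_iff.mp b.linearIndependent _ hy i
  refine ht₂ ⟨fun x w ↦ ?_⟩
  rw [← b'.sum_repr x, sum_lie]
  refine Finset.sum_eq_zero fun i _ ↦ ?_
  rw [smul_lie, (Module.forall_dual_apply_eq_zero_iff ℂ _).mp fun f ↦ hzero w f i, smul_zero]
end

section
/- Let $\mathfrak{g}$ be a complex simple Lie algebra and let $V_1, V_2$ be finite-dimensional irreducible $\mathfrak{g}$-modules, each of dimension at least $2$. Then the $\mathfrak{g}$-module $V_1 \otimes V_2$ admits a proper nonzero submodule. -/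
open scoped TensorProduct

namespace LieModule

section Faithful

variable {K L M : Type*} [Field K] [LieRing L] [LieAlgebra K L]
  [AddCommGroup M] [Module K M] [LieRingModule L M] [LieModule K L M]

/-- A Lie algebra acts nontrivially on an irreducible module of dimension at least two. -/
lemma ker_ne_top_of_isIrreducible [IsIrreducible K L M] (hd : 2 ≤ Module.finrank K M) :
    LieModule.ker K L M ≠ ⊤ := by
  intro h
  have htriv (x : L) (m : M) : ⁅x, m⁆ = 0 := by
    have hx : x ∈ LieModule.ker K L M := h ▸ LieSubmodule.mem_top x
    exact (LieModule.mem_ker K L M x).mp hx m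
  have : Nontrivial M := nontrivial_of_isIrreducible K L M
  obtain ⟨v, hv⟩ := exists_ne (0 : M)
  let N : LieSubmodule K L M :=
    { K ∙ v with lie_mem := fun {x m} _ ↦ by rw [htriv]; exact zero_mem (K ∙ v) }
  have hvN : v ∈ N := Submodule.mem_span_singleton_self v
  have hN : N = ⊤ := (eq_bot_or_eq_top N).resolve_left fun h0 ↦
    hv (by simpa [h0] using hvN)
  have hspan : K ∙ v = ⊤ := congrArg LieSubmodule.toSubmodule hN
  have := finrank_span_singleton (K := K) hv
  rw [hspan, finrank_top] at this
  omega

/-- An irreducible module of dimension at least two over a simple Lie algebra is faithful. -/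
lemma eq_zero_of_forall_lie_eq_zero [LieAlgebra.IsSimple K L] [IsIrreducible K L M]
    (hd : 2 ≤ Module.finrank K M) {x : L} (hx : ∀ m : M, ⁅x, m⁆ = 0) : x = 0 := by
  have hker := (LieAlgebra.IsSimple.eq_bot_or_eq_top (LieModule.ker K L M)).resolve_right
    (ker_ne_top_of_isIrreducible hd)
  have : x ∈ LieModule.ker K L M := (LieModule.mem_ker K L M x).mpr hx
  simpa [hker] using this

/-- A simple Lie algebra with a finite-dimensional irreducible module of dimension at least two
is itself finite-dimensional. -/
lemma finiteDimensional_of_isIrreducible [LieAlgebra.IsSimple K L] [IsIrreducible K L M]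
    [FiniteDimensional K M] (hd : 2 ≤ Module.finrank K M) : FiniteDimensional K L := by
  refine Module.Finite.of_injective (toEnd K L M : L →ₗ[K] Module.End K M) ?_
  refine (injective_iff_map_eq_zero _).mpr fun x hx ↦ ?_
  exact eq_zero_of_forall_lie_eq_zero (K := K) hd fun m ↦ LinearMap.congr_fun hx m

end Faithful

section Casimir

variable {K L : Type*} [Field K] [LieRing L] [LieAlgebra K L]
  [LieAlgebra.IsKilling K L] {ι : Type*} [Fintype ι] [DecidableEq ι] (b : Module.Basis ι K L)

/-- The basis dual to `b` with respect to the Killing form. -/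
noncomputable def killingDualBasis : Module.Basis ι K L :=
  LinearMap.BilinForm.dualBasis (killingForm K L)
    (LieAlgebra.IsKilling.killingForm_nondegenerate K L) b

lemma killingDualBasis_repr (x : L) (i : ι) :
    (killingDualBasis b).repr x i = killingForm K L x (b i) :=
  LinearMap.BilinForm.dualBasis_repr_apply _ _ x i

lemma repr_eq_killingForm (x : L) (i : ι) :
    b.repr x i = killingForm K L x (killingDualBasis b i) := by
  conv_rhs => rw [← b.sum_repr x]
  rw [traceForm_comm]
  simp only [map_sum, map_smul, smul_eq_mul, ← killingDualBasis_repr,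
    Module.Basis.repr_self, Finsupp.single_apply]
  simp

/-- The tensor `∑ i, b i ⊗ b' i`, with `b'` the basis dual to `b`, is invariant under the adjoint
action. -/
lemma sum_lie_killingDualBasis {W : Type*} [AddCommGroup W] [Module K W]
    (f : L →ₗ[K] L →ₗ[K] W) (y : L) :
    ∑ i, (f ⁅y, b i⁆ (killingDualBasis b i) + f (b i) ⁅y, killingDualBasis b i⁆) = 0 := by
  have h₁ (i : ι) : f ⁅y, b i⁆ (killingDualBasis b i) =
      ∑ j, killingForm K L ⁅y, b i⁆ (killingDualBasis b j) • f (b j) (killingDualBasis b i) := by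
    conv_lhs => rw [← b.sum_repr ⁅y, b i⁆]
    simp [repr_eq_killingForm]
  have h₂ (i : ι) : f (b i) ⁅y, killingDualBasis b i⁆ =
      ∑ j, killingForm K L ⁅y, killingDualBasis b i⁆ (b j) • f (b i) (killingDualBasis b j) := by
    conv_lhs => rw [← (killingDualBasis b).sum_repr ⁅y, killingDualBasis b i⁆]
    simp [killingDualBasis_repr]
  simp only [Finset.sum_add_distrib, h₁, h₂]
  rw [Finset.sum_comm, ← Finset.sum_add_distrib]
  refine Finset.sum_eq_zero fun i _ ↦ ?_
  rw [← Finset.sum_add_distrib]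
  refine Finset.sum_eq_zero fun j _ ↦ ?_
  rw [← add_smul, traceForm_apply_lie_apply' K L L y (killingDualBasis b i) (b j),
    traceForm_comm K L L (killingDualBasis b i), add_neg_cancel, zero_smul]

variable (V W : Type*)
  [AddCommGroup V] [Module K V] [LieRingModule L V] [LieModule K L V]
  [AddCommGroup W] [Module K W] [LieRingModule L W] [LieModule K L W]

/-- The split Casimir operator on a tensor product of Lie modules. -/
noncomputable def splitCasimir : V ⊗[K] W →ₗ[K] V ⊗[K] W :=
  ∑ i, TensorProduct.map (toEnd K L V (b i)) (toEnd K L W (killingDualBasis b i))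

variable {V W}

lemma splitCasimir_tmul (v : V) (w : W) :
    splitCasimir b V W (v ⊗ₜ w) = ∑ i, ⁅b i, v⁆ ⊗ₜ[K] ⁅killingDualBasis b i, w⁆ := by
  simp [splitCasimir]

lemma splitCasimir_lie (y : L) (t : V ⊗[K] W) :
    splitCasimir b V W ⁅y, t⁆ = ⁅y, splitCasimir b V W t⁆ := by
  induction t with
  | zero => simp
  | add s t hs ht => simp [hs, ht]
  | tmul v w =>
    have h := sum_lie_killingDualBasis b
      ((TensorProduct.mk K V W).compl₁₂ ((toEnd K L V : L →ₗ[K] Module.End K V).flip v)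
        ((toEnd K L W : L →ₗ[K] Module.End K W).flip w)) y
    rw [← sub_eq_zero, ← neg_eq_zero, ← h]
    simp only [TensorProduct.LieModule.lie_tmul_right, map_add, splitCasimir_tmul, lie_sum, ← Finset.sum_add_distrib,
      ← Finset.sum_sub_distrib, ← Finset.sum_neg_distrib]
    refine Finset.sum_congr rfl fun i _ ↦ ?_
    simp [TensorProduct.tmul_sub]
    abel

/-- The split Casimir operator is not a scalar when `L` is not abelian and both modules are
faithful. -/
lemma splitCasimir_ne_smul (hL : ¬ IsLieAbelian L)
    (hV : ∀ x : L, (∀ v : V, ⁅x, v⁆ = 0) → x = 0) (hW : ∀ x : L, (∀ w : W, ⁅x, w⁆ = 0) → x = 0)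
    (c : K) : ¬ ∀ t, splitCasimir b V W t = c • t := by
  intro hc
  refine hL ⟨fun y x ↦ hV _ fun v ↦ ?_⟩
  have hcomm (w : W) : ∑ i, ⁅⁅y, b i⁆, v⁆ ⊗ₜ[K] ⁅killingDualBasis b i, w⁆ = 0 := by
    have h₁ := congrArg (LinearMap.rTensor W (toEnd K L V y)) (hc (v ⊗ₜ w))
    have h₂ := hc (⁅y, v⁆ ⊗ₜ w)
    simp only [splitCasimir_tmul, map_sum, map_smul, LinearMap.rTensor_tmul,
      toEnd_apply_apply] at h₁ h₂
    simp only [lie_lie, TensorProduct.sub_tmul, Finset.sum_sub_distrib]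
    rw [h₁, h₂, sub_self]
  refine (Module.forall_dual_apply_eq_zero_iff K _).mp fun f ↦ ?_
  have hz : ∑ i, f ⁅⁅y, b i⁆, v⁆ • killingDualBasis b i = 0 := hW _ fun w ↦ by
    have := congrArg (TensorProduct.lid K W ∘ LinearMap.rTensor W f) (hcomm w)
    simpa [sum_lie] using this
  have hi (i : ι) : f ⁅⁅y, b i⁆, v⁆ = 0 :=
    Fintype.linearIndependent_iff.mp (killingDualBasis b).linearIndependent _ hz i
  have hzero : f ∘ₗ (toEnd K L V : L →ₗ[K] Module.End K V).flip v ∘ₗ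
      (LieAlgebra.ad K L y : L →ₗ[K] L) = 0 :=
    b.ext fun i ↦ by simpa using hi i
  simpa using LinearMap.congr_fun hzero x

/-- A tensor product of faithful modules over a nonabelian Lie algebra with nondegenerate Killing
form is reducible. -/
lemma exists_ne_bot_ne_top_tensorProduct [FiniteDimensional K L] [IsAlgClosed K] [Nontrivial V] [Nontrivial W]
    [FiniteDimensional K V] [FiniteDimensional K W] (hL : ¬ IsLieAbelian L)
    (hV : ∀ x : L, (∀ v : V, ⁅x, v⁆ = 0) → x = 0)
    (hW : ∀ x : L, (∀ w : W, ⁅x, w⁆ = 0) → x = 0) :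
    ∃ N : LieSubmodule K L (V ⊗[K] W), N ≠ ⊥ ∧ N ≠ ⊤ := by
  classical
  let b := Module.finBasis K L
  obtain ⟨c, hc⟩ := Module.End.exists_eigenvalue (splitCasimir b V W)
  let N : LieSubmodule K L (V ⊗[K] W) :=
    { Module.End.eigenspace (splitCasimir b V W) c with
      lie_mem := fun {x t} ht ↦ by
        have ht : splitCasimir b V W t = c • t := Module.End.mem_eigenspace_iff.mp ht
        refine Module.End.mem_eigenspace_iff.mpr ?_
        rw [splitCasimir_lie, ht, lie_smul] }
  refine ⟨N, fun h ↦ hc (congrArg LieSubmodule.toSubmodule h), fun h ↦ ?_⟩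
  refine splitCasimir_ne_smul b hL hV hW c fun t ↦ ?_
  have ht : t ∈ N := h ▸ LieSubmodule.mem_top t
  exact Module.End.mem_eigenspace_iff.mp ht

end Casimir

end LieModule

/-- If `g` is a complex simple Lie algebra and `V₁, V₂` are finite-dimensional
irreducible `g`-modules of dimension at least `2`, then `V₁ ⊗ V₂` admits a proper nonzero
`g`-submodule. -/
theorem tensor_product_has_proper_nonzero_submodule
    (g : Type*) [LieRing g] [LieAlgebra ℂ g] [LieAlgebra.IsSimple ℂ g]
    (V₁ V₂ : Type*)
    [AddCommGroup V₁] [Module ℂ V₁] [LieRingModule g V₁] [LieModule ℂ g V₁]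
    [FiniteDimensional ℂ V₁]
    [AddCommGroup V₂] [Module ℂ V₂] [LieRingModule g V₂] [LieModule ℂ g V₂]
    [FiniteDimensional ℂ V₂]
    (h₁ : LieModule.IsIrreducible ℂ g V₁) (h₂ : LieModule.IsIrreducible ℂ g V₂)
    (hd₁ : 2 ≤ Module.finrank ℂ V₁) (hd₂ : 2 ≤ Module.finrank ℂ V₂) :
    ∃ N : LieSubmodule ℂ g (V₁ ⊗[ℂ] V₂), N ≠ ⊥ ∧ N ≠ ⊤ := by
  have : FiniteDimensional ℂ g := LieModule.finiteDimensional_of_isIrreducible (M := V₁) hd₁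
  have : Nontrivial V₁ := LieModule.nontrivial_of_isIrreducible ℂ g V₁
  have : Nontrivial V₂ := LieModule.nontrivial_of_isIrreducible ℂ g V₂
  exact LieModule.exists_ne_bot_ne_top_tensorProduct (LieAlgebra.IsSimple.non_abelian ℂ)
    (fun _ ↦ LieModule.eq_zero_of_forall_lie_eq_zero (K := ℂ) hd₁)
    (fun _ ↦ LieModule.eq_zero_of_forall_lie_eq_zero (K := ℂ) hd₂)
end

section
/- Let $\mathfrak{h}$ be a finite-dimensional complex Lie algebra, $\mathfrak{g}$ a semisimple complex Lie algebra, and $\rho' : \mathfrak{h} \to \mathfrak{g}$ a surjective Lie algebra homomorphism. Then there exists a Lie algebra homomorphism $\tau : \mathfrak{g} \to \mathfrak{h}$ with $\rho' \circ \tau = \mathrm{id}_{\mathfrak{g}}$. -/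
section

open Module LieAlgebra LieModule

section Trace

variable {K V : Type*} [Field K] [CharZero K] [AddCommGroup V] [Module K V] [FiniteDimensional K V]

open Polynomial in
/-- If an endomorphism `T` is not nilpotent, then some multiple of `T` by a polynomial in `T` has
non-zero trace. -/
theorem LinearMap.exists_trace_mul_aeval_ne_zero {T : End K V} (hT : ¬ IsNilpotent T) :
    ∃ r : K[X], LinearMap.trace K V (T * aeval T r) ≠ 0 := by
  have hm : minpoly K T ≠ 0 := minpoly.ne_zero (Algebra.IsIntegral.isIntegral T)
  obtain ⟨q, hq, hXq⟩ := exists_eq_pow_rootMultiplicity_mul_and_not_dvd _ hm 0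
  rw [C_0, sub_zero] at hq hXq
  set k := rootMultiplicity 0 (minpoly K T)
  have hcop : IsCoprime (X ^ (k + 1)) q :=
    ((irreducible_X.coprime_iff_not_dvd).2 hXq).pow_left
  obtain ⟨a, b, hab⟩ := hcop
  have hTq : T ^ k * aeval T q = 0 := by
    have := minpoly.aeval K T
    rwa [hq, map_mul, map_pow, aeval_X] at this
  refine ⟨a * X ^ k, fun h0 ↦ hT ⟨k, ?_⟩⟩
  set E := T * aeval T (a * X ^ k) with hE
  have hE' : E = aeval T (a * X ^ (k + 1)) := by
    rw [hE, show a * X ^ (k + 1) = X * (a * X ^ k) by ring, map_mul _ X, aeval_X]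
  have hidem : IsIdempotentElem E := by
    have : E * aeval T (b * q) = 0 := by
      rw [hE', ← map_mul, show a * X ^ (k + 1) * (b * q) = (a * b * X) * (X ^ k * q) by ring,
        map_mul, map_mul _ (X ^ k), map_pow, aeval_X, hTq, mul_zero]
    rw [IsIdempotentElem, ← sub_eq_zero]
    rw [show b * q = 1 - a * X ^ (k + 1) by rw [← hab]; ring, map_sub, ← hE', map_one, mul_sub,
      mul_one] at this
    rw [← neg_sub, this, neg_zero]
  have hE0 : E = 0 := LinearMap.IsIdempotentElem.eq_zero_of_trace_eq_zero hidem h0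
  have h1 : aeval T (b * q) = 1 := by
    rw [← sub_eq_iff_eq_add'.2 hab.symm, map_sub, ← hE', hE0, map_one, sub_zero]
  rw [← mul_one (T ^ k), ← h1, mul_comm b q, map_mul, ← mul_assoc, hTq, zero_mul]

end Trace

namespace LieAlgebra

variable {K L : Type*} [Field K] [LieRing L] [LieAlgebra K L] [FiniteDimensional K L]
  [IsKilling K L]

/-- An endomorphism of the adjoint module of a semisimple Lie algebra whose square is zero is
zero. -/
theorem eq_zero_of_mul_self_eq_zero {T : End K L} (hT : ∀ x y : L, T ⁅x, y⁆ = ⁅x, T y⁆)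
    (h : T * T = 0) : T = 0 := by
  let φ : L →ₗ⁅K,L⁆ L := { T with map_lie' := hT _ _ }
  have : IsLieAbelian φ.range := by
    refine ⟨fun ⟨x, hx⟩ ⟨y, hy⟩ ↦ Subtype.ext ?_⟩
    obtain ⟨x, rfl⟩ := hx
    obtain ⟨y, rfl⟩ := hy
    change ⁅T x, T y⁆ = 0
    rw [← hT, ← lie_skew, map_neg, hT, neg_eq_zero]
    exact (congr_arg (⁅y, ·⁆) (LinearMap.congr_fun h x)).trans (lie_zero y)
  have h0 : φ.range = ⊥ := IsKilling.ideal_eq_bot_of_isLieAbelian _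
  ext x
  have : φ x ∈ φ.range := ⟨x, rfl⟩
  rwa [h0, LieSubmodule.mem_bot] at this

/-- A nilpotent endomorphism of the adjoint module of a semisimple Lie algebra is zero. -/
theorem eq_zero_of_isNilpotent_of_equivariant {T : End K L} (hT : ∀ x y : L, T ⁅x, y⁆ = ⁅x, T y⁆)
    (h : IsNilpotent T) : T = 0 := by
  have key (n : ℕ) : ∀ S : End K L, (∀ x y : L, S ⁅x, y⁆ = ⁅x, S y⁆) → S ^ 2 ^ n = 0 → S = 0 := by
    induction n with
    | zero => intro S _ h; simpa using h
    | succ n ih =>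
      intro S hS h
      refine eq_zero_of_mul_self_eq_zero hS (ih _ (fun x y ↦ ?_) ?_)
      · simp [hS]
      · rwa [← sq, ← pow_mul, ← pow_succ']
  obtain ⟨n, hn⟩ := h
  exact key n T hT (pow_eq_zero_of_le Nat.lt_two_pow_self.le hn)

variable (K L) in
theorem derivedSeries_one_eq_top : derivedSeries K L 1 = ⊤ := by
  set J := derivedSeries K L 1
  have hc := J.isCompl_killingCompl
  have : IsLieAbelian J.killingCompl := by
    refine ⟨fun x y ↦ Subtype.ext ?_⟩
    have h1 : ⁅(x : L), (y : L)⁆ ∈ J := LieSubmodule.lie_mem_lie trivial trivial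
    have h2 : ⁅(x : L), (y : L)⁆ ∈ J.killingCompl := lie_mem_right K L _ _ _ y.2
    simpa [hc.inf_eq_bot] using (LieSubmodule.mem_inf ..).2 ⟨h1, h2⟩
  simpa [IsKilling.ideal_eq_bot_of_isLieAbelian J.killingCompl] using hc.sup_eq_top

end LieAlgebra

namespace LieModule

/-- Half of **Schur's lemma**. -/
theorem bijective_of_isIrreducible {K L M : Type*} [Field K] [LieRing L] [AddCommGroup M]
    [Module K M] [FiniteDimensional K M] [LieRingModule L M] [IsIrreducible K L M]
    (φ : M →ₗ⁅K,L⁆ M) (hφ : φ ≠ 0) : Function.Bijective φ := by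
  have hker : φ.ker = ⊥ := by
    refine (IsSimpleOrder.eq_bot_or_eq_top φ.ker).resolve_right fun h ↦ hφ ?_
    ext m
    exact LieModuleHom.mem_ker.1 (h ▸ LieSubmodule.mem_top m)
  have hinj : Function.Injective (φ : M →ₗ[K] M) := by
    rw [← LinearMap.ker_eq_bot]
    simpa using! congr_arg LieSubmodule.toSubmodule hker
  exact ⟨hinj, LinearMap.injective_iff_surjective.1 hinj⟩

variable {K L M : Type*} [Field K] [LieRing L] [LieAlgebra K L]
  [FiniteDimensional K L] [IsKilling K L] [AddCommGroup M] [Module K M] [LieRingModule L M]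
  [LieModule K L M] [FiniteDimensional K M]

open LieModule.Cohomology

/-- A scalar 2-cocycle `f` on a semisimple Lie algebra is a coboundary. -/
theorem exists_killingForm_eq (f : L →ₗ[K] L →ₗ[K] K)
    (hf : ∀ x, f x x = 0) (hf' : ∀ x y z, f ⁅x, y⁆ z = f ⁅x, z⁆ y - f ⁅y, z⁆ x) :
    ∃ d : L, ∀ x y, f x y = killingForm K L d ⁅x, y⁆ := by
  have hκ := IsKilling.killingForm_nondegenerate K L
  let T : End K L := ((killingForm K L).toDual hκ).symm ∘ₗ f
  have hT (x y : L) : killingForm K L (T x) y = f x y :=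
    LinearMap.BilinForm.apply_toDual_symm_apply (hB := hκ) _ _
  have hskew (x y : L) : f x y = - f y x := (LinearMap.IsAlt.neg (B := f) hf y x).symm
  let D : LieDerivation K L L :=
    { T with
      leibniz' := fun x y ↦ by
        refine ((killingForm K L).toDual hκ).injective (LinearMap.ext fun z ↦ ?_)
        change killingForm K L (T ⁅x, y⁆) z = killingForm K L (⁅x, T y⁆ - ⁅y, T x⁆) z
        rw [map_sub, LinearMap.sub_apply, traceForm_apply_lie_apply' K L L x,
          traceForm_apply_lie_apply' K L L y, hT, hT, hT, hf', hskew y, hskew x]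
        ring }
  obtain ⟨d, hd⟩ := LieDerivation.IsKilling.exists_eq_ad D
  refine ⟨d, fun x y ↦ ?_⟩
  rw [← traceForm_apply_lie_apply, ← hT, ← LieDerivation.ad_apply_apply (R := K), hd]
  rfl

theorem exists_d₁₂_eq_of_isTrivial [IsTrivial L M] (c : twoCocycle K L M) :
    ∃ t : oneCochain K L M, d₁₂ K L M t = c := by
  obtain ⟨c, hc⟩ := c
  let b := finBasis K M
  have h (i) : ∃ d : L, ∀ x y, b.coord i (c x y) = killingForm K L d ⁅x, y⁆ := by
    refine exists_killingForm_eq (c.1.compr₂ (b.coord i)) (by simp) fun x y z ↦ ?_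
    have h3 : d₂₃ K L M c x y z = 0 := by
      rw [(mem_twoCocycle_iff K L M c).1 hc]; simp
    simp only [d₂₃_apply, trivial_lie_zero] at h3
    simp only [LinearMap.compr₂_apply, twoCochain_val_apply, ← map_sub]
    congr 1
    rw [← sub_eq_zero, ← neg_eq_zero, ← h3]
    abel
  choose d hd using h
  refine ⟨- ∑ i, (killingForm K L (d i)).smulRight (b i), ?_⟩
  ext x y
  simp only [twoCochain_val_apply, d₁₂_apply_apply_ofTrivial]
  conv_rhs => rw [← b.sum_repr (c x y)]
  simp only [← b.coord_apply, hd]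
  simp [LinearMap.sum_apply]

variable [CharZero K]

variable (K L M) in
theorem isTrivial_of_traceForm_eq_zero [IsIrreducible K L M] (h : traceForm K L M = 0) :
    IsTrivial L M := by
  have := isNilpotent_derivedSeries_of_traceForm_eq_zero h
  have : IsNilpotent L M := by
    rw [isNilpotent_iff_forall' (R := K)] at this ⊢
    exact fun x ↦ this ⟨x, by rw [derivedSeries_one_eq_top]; trivial⟩
  have := nontrivial_of_isIrreducible K L M
  have := nontrivial_max_triv_of_isNilpotent K L M
  rw [isTrivial_iff_max_triv_eq_top K]
  exact LieSubmodule.eq_top_of_isIrreducible _ _ _ _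

/-- A nontrivial irreducible module of a semisimple Lie algebra has an invertible Casimir operator,
attached to an invariant tensor `∑ i, e i ⊗ e' i`. -/
theorem exists_invariant_casimir_bijective [IsIrreducible K L M] (hM : ¬ IsTrivial L M) :
    ∃ (n : ℕ) (e e' : Fin n → L),
      (∀ (β : L →ₗ[K] L →ₗ[K] M) (x : L),
        ∑ i, β ⁅x, e i⁆ (e' i) = - ∑ i, β (e i) ⁅x, e' i⁆) ∧
      ∃ φ : M →ₗ⁅K,L⁆ M, Function.Bijective φ ∧ ∀ m, φ m = ∑ i, ⁅e i, ⁅e' i, m⁆⁆ := by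
  have hκ := IsKilling.killingForm_nondegenerate K L
  let T : End K L := ((killingForm K L).toDual hκ).symm ∘ₗ traceForm K L M
  have hTκ (x y : L) : killingForm K L (T x) y = traceForm K L M x y :=
    LinearMap.BilinForm.apply_toDual_symm_apply (hB := hκ) _ _
  have hT (x y : L) : T ⁅x, y⁆ = ⁅x, T y⁆ := by
    refine ((killingForm K L).toDual hκ).injective (LinearMap.ext fun z ↦ ?_)
    simp only [LinearMap.BilinForm.toDual_def]
    rw [hTκ, traceForm_apply_lie_apply', traceForm_apply_lie_apply', hTκ]
  have hTnil : ¬ _root_.IsNilpotent T := by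
    intro h
    have h0 := eq_zero_of_isNilpotent_of_equivariant hT h
    refine hM (isTrivial_of_traceForm_eq_zero K L M ?_)
    ext x y
    rw [← hTκ, h0]
    simp
  obtain ⟨r, hr⟩ := LinearMap.exists_trace_mul_aeval_ne_zero hTnil
  set p := Polynomial.aeval T r
  have hp (x y : L) : p ⁅x, y⁆ = ⁅x, p y⁆ := by
    have h1 : Commute (ad K L x) T := LinearMap.ext fun y ↦ (hT x y).symm
    have h2 : Commute (ad K L x) p :=
      Algebra.commute_of_mem_adjoin_singleton_of_commute (Polynomial.aeval_mem_adjoin_singleton _ _)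
        h1
    exact (LinearMap.congr_fun h2.eq y).symm
  let b := finBasis K L
  let b' := (killingForm K L).dualBasis hκ b
  have hb (x : L) (i) : b.repr x i = killingForm K L (b' i) x := by
    conv_rhs => rw [← b.sum_repr x, map_sum]
    simp only [map_smul, smul_eq_mul, b', LinearMap.BilinForm.apply_dualBasis_left]
    simp
  have hb' (x : L) (i) : b'.repr x i = killingForm K L x (b i) :=
    LinearMap.BilinForm.dualBasis_repr_apply ..
  have hinv (β : L →ₗ[K] L →ₗ[K] M) (x : L) :
      ∑ i, β ⁅x, p (b i)⁆ (b' i) = - ∑ i, β (p (b i)) ⁅x, b' i⁆ := by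
    have h1 (i) : β ⁅x, p (b i)⁆ (b' i) =
        ∑ j, killingForm K L (b' j) ⁅x, b i⁆ • β (p (b j)) (b' i) := by
      rw [← hp]
      conv_lhs => rw [← b.sum_repr ⁅x, b i⁆]
      simp [hb]
    have h2 (i) : β (p (b i)) ⁅x, b' i⁆ =
        ∑ j, killingForm K L ⁅x, b' i⁆ (b j) • β (p (b i)) (b' j) := by
      conv_lhs => rw [← b'.sum_repr ⁅x, b' i⁆]
      simp [hb']
    simp_rw [h1, h2]
    rw [Finset.sum_comm, ← Finset.sum_neg_distrib]
    refine Finset.sum_congr rfl fun i _ ↦ ?_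
    rw [← Finset.sum_neg_distrib]
    refine Finset.sum_congr rfl fun j _ ↦ ?_
    rw [traceForm_apply_lie_apply' K L L x, neg_smul, neg_neg]
  refine ⟨_, p ∘ b, b', hinv, ?_⟩
  let C : End K M := ∑ i, toEnd K L M (p (b i)) * toEnd K L M (b' i)
  have hC (m : M) : C m = ∑ i, ⁅p (b i), ⁅b' i, m⁆⁆ := by
    simp [C, LinearMap.sum_apply]
  let φ : M →ₗ⁅K,L⁆ M :=
    { C with
      map_lie' := by
        intro x m
        change C ⁅x, m⁆ = ⁅x, C m⁆
        let β : L →ₗ[K] L →ₗ[K] M := LinearMap.mk₂ K (fun a b ↦ ⁅a, ⁅b, m⁆⁆)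
          (by simp) (by simp) (by simp) (by simp)
        have h := hinv β x
        simp only [β, LinearMap.mk₂_apply] at h
        rw [hC, hC, lie_sum, eq_comm, ← sub_eq_zero, ← Finset.sum_sub_distrib,
          ← add_eq_zero_iff_eq_neg.2 h, ← Finset.sum_add_distrib]
        refine Finset.sum_congr rfl fun i _ ↦ ?_
        simp only [lie_lie, lie_sub]
        abel }
  have hφ : φ ≠ 0 := by
    intro h
    have hC0 : C = 0 := by
      ext m
      exact LieModuleHom.congr_fun h m
    refine hr ?_
    rw [LinearMap.trace_eq_matrix_trace K b, Matrix.trace]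
    have : LinearMap.trace K M C = 0 := by simp [hC0]
    rw [map_sum] at this
    rw [← this]
    refine Finset.sum_congr rfl fun i _ ↦ ?_
    rw [Matrix.diag_apply, LinearMap.toMatrix_apply, hb, traceForm_comm, Module.End.mul_apply, hTκ]
    rfl
  exact ⟨φ, bijective_of_isIrreducible φ hφ, hC⟩

theorem exists_d₁₂_eq_of_not_isTrivial [IsIrreducible K L M] (hM : ¬ IsTrivial L M)
    (c : twoCocycle K L M) : ∃ t : oneCochain K L M, d₁₂ K L M t = c := by
  obtain ⟨n, e, e', hinv, φ, hφ, hφe⟩ := exists_invariant_casimir_bijective (K := K) hM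
  obtain ⟨c, hc⟩ := c
  let φ' : M ≃ₗ[K] M := LinearEquiv.ofBijective (φ : M →ₗ[K] M) hφ
  have hφ' (m : M) : φ (φ'.symm m) = m := φ'.apply_symm_apply m
  let θ : L →ₗ[K] M := ∑ i, toEnd K L M (e i) ∘ₗ c.1 (e' i)
  have hθ (x : L) : θ x = ∑ i, ⁅e i, c (e' i) x⁆ := by
    simp [θ, LinearMap.sum_apply]
  have hβ (x y : L) : ∑ i, ⁅⁅x, e i⁆, c (e' i) y⁆ = - ∑ i, ⁅e i, c ⁅x, e' i⁆ y⁆ := by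
    let β : L →ₗ[K] L →ₗ[K] M := LinearMap.mk₂ K (fun a b ↦ ⁅a, c b y⁆)
      (by simp) (by simp) (by simp) (by simp)
    simpa [β] using hinv β x
  refine ⟨φ'.symm ∘ₗ θ, ?_⟩
  ext x y
  apply hφ.injective
  simp only [twoCochain_val_apply, d₁₂_apply_apply, LinearMap.comp_apply, LinearEquiv.coe_coe,
    map_sub, LieModuleHom.map_lie, hφ']
  have h1 := hβ x y
  have h2 := hβ y x
  simp only [hφe, hθ, lie_sum]
  rw [← add_eq_zero_iff_eq_neg, ← Finset.sum_add_distrib] at h1 h2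
  rw [← sub_zero (∑ i, ⁅x, _⁆), ← h1, ← sub_zero (∑ i, ⁅y, _⁆), ← h2]
  simp only [← Finset.sum_sub_distrib]
  refine Finset.sum_congr rfl fun i _ ↦ ?_
  have h3 : d₂₃ K L M c (e' i) x y = 0 := by
    rw [(mem_twoCocycle_iff K L M c).1 hc]; simp
  rw [d₂₃_apply, ← lie_skew (e' i) x, ← lie_skew (e' i) y, ← twoCochain_skew c (e' i) ⁅x, y⁆] at h3
  rw [← sub_eq_zero, ← lie_zero (e i), ← neg_zero, ← h3]
  simp only [lie_lie, neg_sub, lie_sub, lie_add, lie_neg, map_neg, LinearMap.neg_apply]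
  abel

/-- **Whitehead's second lemma** for irreducible modules. -/
theorem exists_d₁₂_eq [IsIrreducible K L M] (c : twoCocycle K L M) :
    ∃ t : oneCochain K L M, d₁₂ K L M t = c := by
  by_cases hM : IsTrivial L M
  · exact exists_d₁₂_eq_of_isTrivial c
  · exact exists_d₁₂_eq_of_not_isTrivial hM c

end LieModule

namespace LieAlgebra

section Abelian

variable {K L N : Type*} [Field K] [CharZero K] [LieRing L] [LieAlgebra K L] [FiniteDimensional K L]
  [IsKilling K L] [LieRing N] [LieAlgebra K N]

open LieModule.Cohomology in
/-- An extension of a semisimple Lie algebra by an abelian Lie algebra that is irreducible as a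
module splits. -/
theorem Extension.exists_rightInverse_of_isIrreducible [IsLieAbelian N] [FiniteDimensional K N]
    (E : Extension K N L)
    (hE : letI := E.ringModuleOf; IsIrreducible K L N) :
    ∃ τ : L →ₗ⁅K⁆ E.L, ∀ x, E.proj (τ x) = x := by
  let := E.ringModuleOf
  have := E.lieModuleOf
  obtain ⟨s, hs⟩ := (E.proj : E.L →ₗ[K] L).exists_rightInverse_of_surjective
    (LinearMap.range_eq_top.2 E.proj_surjective)
  have hs' (x : L) : E.proj (s x) = x := LinearMap.congr_fun hs x
  obtain ⟨t, ht⟩ := exists_d₁₂_eq (E.twoCocycleOf hs')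
  have hst (x : L) (m : N) : E.incl ⁅x, m⁆ = ⁅s x, E.incl m⁆ := by
    have h := E.ringModuleOf_bracket_proj m (s x)
    rw [hs'] at h
    change ((E.toKer ⁅x, m⁆ : E.proj.ker) : E.L) = _
    rw [h]
    simp
  have hc (x y : L) : E.incl (d₁₂ K L N t x y) = ⁅s x, s y⁆ - s ⁅x, y⁆ := by
    have h : (E.twoCocycleOf hs').1 x y = E.toKer.symm ⟨⁅s x, s y⁆ - s ⁅x, y⁆, by simp [hs']⟩ := rfl
    rw [ht]
    change ((E.toKer ((E.twoCocycleOf hs').1 x y) : E.proj.ker) : E.L) = _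
    rw [h, LieEquiv.apply_symm_apply]
  refine ⟨{ s - (E.incl : N →ₗ[K] E.L) ∘ₗ t with map_lie' := fun {x y} ↦ ?_ }, fun x ↦ ?_⟩
  · change s ⁅x, y⁆ - E.incl (t ⁅x, y⁆) = ⁅s x - E.incl (t x), s y - E.incl (t y)⁆
    have h := hc x y
    rw [d₁₂_apply_apply, map_sub, map_sub, hst, hst] at h
    have h0 : ⁅E.incl (t x), E.incl (t y)⁆ = 0 := by
      rw [← LieHom.map_lie, trivial_lie_zero, map_zero]
    rw [← sub_eq_zero, ← sub_eq_zero.2 h, sub_lie, lie_sub, lie_sub, h0,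
      ← lie_skew (E.incl (t x))]
    abel
  · change E.proj (s x - E.incl (t x)) = x
    simp [hs']

/-- A surjection onto a semisimple Lie algebra whose kernel is abelian and a minimal ideal
splits. -/
theorem exists_rightInverse_of_isLieAbelian_ker {H : Type*} [LieRing H] [LieAlgebra K H]
    [FiniteDimensional K H] (ρ : H →ₗ⁅K⁆ L) (hρ : Function.Surjective ρ) [IsLieAbelian ρ.ker]
    (h : IsAtom ρ.ker) : ∃ τ : L →ₗ⁅K⁆ H, ∀ x, ρ (τ x) = x := by
  let E := (isExtension_of_surjective ρ hρ).extension
  refine E.exists_rightInverse_of_isIrreducible ?_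
  let := E.ringModuleOf
  have := E.lieModuleOf
  have hE (z : H) (m : ρ.ker) : ((⁅ρ z, m⁆ : ρ.ker) : H) = ⁅z, (m : H)⁆ := by
    have h := congr_arg (fun k ↦ ((E.toKer k : E.proj.ker) : E.L)) (E.ringModuleOf_bracket_proj m z)
    simp only [LieEquiv.apply_symm_apply] at h
    exact h
  have : Nontrivial ρ.ker := (LieSubmodule.nontrivial_iff_ne_bot K H H).2 h.1
  refine IsIrreducible.mk fun S hS ↦ ?_
  let I : LieIdeal K H :=
    { S.toSubmodule.map ρ.ker.toSubmodule.subtype with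
      lie_mem := by
        rintro z _ ⟨m, hm, rfl⟩
        exact ⟨⁅ρ z, m⁆, S.lie_mem hm, hE z m⟩ }
  have hI (m : ρ.ker) : (m : H) ∈ I ↔ m ∈ S :=
    ⟨fun ⟨k, hk, hkm⟩ ↦ Subtype.ext hkm ▸ hk, fun hm ↦ ⟨m, hm, rfl⟩⟩
  have hle : I ≤ ρ.ker := by
    rintro _ ⟨m, -, rfl⟩
    exact m.2
  obtain hbot | htop := h.le_iff.1 hle
  · refine absurd ((LieSubmodule.eq_bot_iff S).2 fun m hm ↦ ?_) hS
    have := (hI m).2 hm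
    rw [hbot, LieSubmodule.mem_bot] at this
    exact Subtype.ext this
  · exact eq_top_iff.2 fun m _ ↦ (hI m).1 (htop.ge m.2)

end Abelian

variable {K L H : Type*} [Field K] [LieRing L] [LieAlgebra K L] [LieRing H] [LieAlgebra K H]

theorem radical_le_ker_of_surjective [IsNoetherian K L] [HasTrivialRadical K L]
    [IsSolvable (radical K H)] (ρ : H →ₗ⁅K⁆ L) (hρ : Function.Surjective ρ) : radical K H ≤ ρ.ker := by
  let J := (radical K H).map ρ
  let f : radical K H →ₗ⁅K⁆ J :=
    { toFun x := ⟨ρ x, LieIdeal.mem_map x.2⟩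
      map_add' _ _ := Subtype.ext (map_add ρ _ _)
      map_smul' _ _ := Subtype.ext (map_smul ρ _ _)
      map_lie' := Subtype.ext (LieHom.map_lie ρ _ _) }
  have hf : Function.Surjective f := by
    rintro ⟨y, hy⟩
    obtain ⟨x, hx⟩ := LieIdeal.mem_map_of_surjective hρ hy
    exact ⟨x, Subtype.ext hx⟩
  have hJ : IsSolvable J := hf.lieAlgebra_isSolvable
  have : J = ⊥ := by
    rwa [LieIdeal.solvable_iff_le_radical, HasTrivialRadical.radical_eq_bot, le_bot_iff] at hJ
  exact LieIdeal.map_eq_bot_iff.1 this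

theorem exists_rightInverse_of_bijective (ρ : H →ₗ⁅K⁆ L) (hρ : Function.Bijective ρ) :
    ∃ τ : L →ₗ⁅K⁆ H, ∀ x, ρ (τ x) = x :=
  let e := LieEquiv.ofBijective ρ hρ
  ⟨e.symm.toLieHom, e.apply_symm_apply⟩

theorem exists_rightInverse_of_isKilling [FiniteDimensional K H] [IsKilling K H]
    (ρ : H →ₗ⁅K⁆ L) (hρ : Function.Surjective ρ) : ∃ τ : L →ₗ⁅K⁆ H, ∀ x, ρ (τ x) = x := by
  set J := ρ.ker.killingCompl
  have hJ : IsCompl ρ.ker J := ρ.ker.isCompl_killingCompl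
  obtain ⟨τ, hτ⟩ := exists_rightInverse_of_bijective (ρ.comp J.incl) <| by
    constructor
    · refine (injective_iff_map_eq_zero _).2 fun x hx ↦ Subtype.ext ?_
      have : (x : H) ∈ ρ.ker ⊓ J := ⟨hx, x.2⟩
      rwa [hJ.inf_eq_bot] at this
    · intro y
      obtain ⟨x, rfl⟩ := hρ y
      have hx : x ∈ ρ.ker ⊔ J := hJ.sup_eq_top ▸ LieSubmodule.mem_top x
      obtain ⟨a, ha, b, hb, rfl⟩ := (LieSubmodule.mem_sup ..).1 hx
      exact ⟨⟨b, hb⟩, by simp [LieHom.mem_ker.1 ha]⟩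
  exact ⟨J.incl.comp τ, hτ⟩

variable [CharZero K] [FiniteDimensional K L] [IsKilling K L] [FiniteDimensional K H]

/-- A surjection onto a semisimple Lie algebra whose kernel is a minimal ideal splits. -/
theorem exists_rightInverse_of_isAtom_ker (ρ : H →ₗ⁅K⁆ L) (hρ : Function.Surjective ρ)
    (h : IsAtom ρ.ker) : ∃ τ : L →ₗ⁅K⁆ H, ∀ x, ρ (τ x) = x := by
  obtain hrad | hrad := h.le_iff.1 (radical_le_ker_of_surjective ρ hρ)
  · have : HasTrivialRadical K H := ⟨hrad⟩
    exact exists_rightInverse_of_isKilling ρ hρ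
  · have hsol : IsSolvable ρ.ker := hrad ▸ inferInstance
    have hle : derivedAbelianOfIdeal ρ.ker ≤ ρ.ker := by
      unfold derivedAbelianOfIdeal
      split
      · exact bot_le
      · exact derivedSeriesOfIdeal_le_self _ _
    have hab : IsLieAbelian ρ.ker := by
      obtain h0 | h1 := h.le_iff.1 hle
      · exact absurd ((abelian_of_solvable_ideal_eq_bot_iff _).1 h0) h.1
      · have := abelian_derivedAbelianOfIdeal ρ.ker
        rwa [h1] at this
    exact exists_rightInverse_of_isLieAbelian_ker ρ hρ h

/-- **Levi's theorem**: a surjection of a finite-dimensional Lie algebra onto a semisimple Lie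
algebra splits. -/
theorem exists_rightInverse_of_surjective (ρ : H →ₗ⁅K⁆ L) (hρ : Function.Surjective ρ) :
    ∃ τ : L →ₗ⁅K⁆ H, ∀ x, ρ (τ x) = x := by
  induction hn : finrank K H using Nat.strong_induction_on generalizing H with | _ n ih
  by_cases hbot : ρ.ker = ⊥
  · exact exists_rightInverse_of_bijective ρ ⟨(LieHom.ker_eq_bot ρ).1 hbot, hρ⟩
  by_cases hatom : IsAtom ρ.ker
  · exact exists_rightInverse_of_isAtom_ker ρ hρ hatom
  obtain ⟨I, hI, hI0⟩ : ∃ I < ρ.ker, I ≠ ⊥ := by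
    simpa [IsAtom, hbot] using hatom
  let π : H →ₗ⁅K⁆ H ⧸ I :=
    { (LieSubmodule.Quotient.mk' I : H →ₗ[K] H ⧸ I) with
      map_lie' := fun {x y} ↦ LieSubmodule.Quotient.mk_bracket I x y }
  have hπ : Function.Surjective π := LieSubmodule.Quotient.surjective_mk' I
  have hπ0 (x : H) : π x = 0 ↔ x ∈ I := LieSubmodule.Quotient.mk_eq_zero I
  let ρ' : H ⧸ I →ₗ⁅K⁆ L :=
    { I.toSubmodule.liftQ (ρ : H →ₗ[K] L) hI.le with
      map_lie' := by
        intro x y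
        obtain ⟨x, rfl⟩ := hπ x
        obtain ⟨y, rfl⟩ := hπ y
        exact ρ.map_lie x y }
  have hρ' (x : H) : ρ' (π x) = ρ x := rfl
  have hquot : finrank K (H ⧸ I) < n := by
    rw [← hn]
    have h1 := I.toSubmodule.finrank_quotient_add_finrank
    have h2 : 0 < finrank K I.toSubmodule := by
      have : Nontrivial I.toSubmodule := (LieSubmodule.nontrivial_iff_ne_bot K H H).2 hI0
      exact finrank_pos
    change finrank K (H ⧸ I.toSubmodule) < _
    omega
  obtain ⟨σ, hσ⟩ := ih _ hquot ρ' (fun y ↦ (hρ y).imp' π fun x hx ↦ hx) rfl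
  let H' : LieSubalgebra K H := σ.range.comap π
  have hH' : finrank K H' < n := by
    rw [← hn]
    refine Submodule.finrank_lt (s := H'.toSubmodule) fun htop ↦ hI.not_ge fun x hx ↦ ?_
    have : x ∈ H'.toSubmodule := htop ▸ Submodule.mem_top
    obtain ⟨y, hy⟩ : ∃ y, σ y = π x := this
    have h1 := hσ y
    rw [hy, hρ', LieHom.mem_ker.1 hx] at h1
    rw [← h1, map_zero] at hy
    exact (hπ0 x).1 hy.symm
  obtain ⟨τ, hτ⟩ := ih _ hH' (ρ.comp H'.incl) (fun y ↦ by
    obtain ⟨x, hx⟩ := hπ (σ y)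
    exact ⟨⟨x, y, hx.symm⟩, (congr_arg ρ' hx).trans (hσ y)⟩) rfl
  exact ⟨H'.incl.comp τ, hτ⟩

end LieAlgebra

end

/-- A surjective homomorphism from a finite-dimensional complex Lie algebra
onto a (finite-dimensional) semisimple complex Lie algebra splits. -/
theorem surjection_onto_semisimple_lie_algebra_splits
    (h : Type*) [LieRing h] [LieAlgebra ℂ h] [FiniteDimensional ℂ h]
    (g : Type*) [LieRing g] [LieAlgebra ℂ g] [FiniteDimensional ℂ g]
    [LieAlgebra.IsSemisimple ℂ g]
    (ρ' : h →ₗ⁅ℂ⁆ g) (hρ' : Function.Surjective ρ') :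
    ∃ τ : g →ₗ⁅ℂ⁆ h, ρ'.comp τ = LieHom.id := by
  obtain ⟨τ, hτ⟩ := LieAlgebra.exists_rightInverse_of_surjective ρ' hρ'
  exact ⟨τ, LieHom.ext hτ⟩
end
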